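/- Consider the doubled quartet construction: starting from the two incompatible quartets T_1 = ab|cd and T_2 = ac|bd, each with a unique degree-2 vertex subdividing its middle edge, set T^0_j = T_j and T^{i+1}_j = (T^i_j, T^i_j) for j ∈ {1,2}, where the taxa of the new copies are labelled identically in both trees so that T^i_1 and T^i_2 are on a common taxon set, and let D^i = D(T^i_1, T^i_2). Then for every i ≥ 0, tw(D^i) = 3, i.e., d_tw(T^i_1, T^i_2) = 1. -/

import Mathlib

open SimpleGraph

/-- `G` has a tree decomposition of width at most `k`: a tree `t` together with
bags satisfying (tw1), (tw2) and (tw3), all of whose bags have size at most `k+1`. -/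
def HasTreeDecompWidthLE {V : Type*} (G : SimpleGraph V) (k : ℕ) : Prop :=
  ∃ (n : ℕ) (t : SimpleGraph (Fin (n + 1))) (bag : Fin (n + 1) → Finset V),
    t.IsTree ∧
    (∀ v : V, ∃ i, v ∈ bag i) ∧
    (∀ u v : V, G.Adj u v → ∃ i, u ∈ bag i ∧ v ∈ bag i) ∧
    (∀ v : V, (t.induce {i | v ∈ bag i}).Connected) ∧
    (∀ i, (bag i).card ≤ k + 1)

/-- The treewidth of a graph: the least `k` such that `G` has a tree decomposition
of width `k`. -/
noncomputable def treewidth {V : Type*} (G : SimpleGraph V) : ℕ :=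
  sInf {k | HasTreeDecompWidthLE G k}

/-- An unrooted binary phylogenetic graph (tree or network) on label set `X`:
a finite connected graph whose degree-1 vertices are bijectively labelled by `X`
and all of whose other vertices have degree 3. -/
structure PhyloGraph (V : Type*) (X : Type*) where
  graph : SimpleGraph V
  finite : Finite V
  connected : graph.Connected
  leaf : X → V
  leaf_inj : Function.Injective leaf
  leaf_deg : ∀ x : X, (graph.neighborSet (leaf x)).ncard = 1
  internal_deg : ∀ v : V, (∀ x : X, leaf x ≠ v) → (graph.neighborSet v).ncard = 3

/-- An unrooted binary phylogenetic tree on label set `X`. -/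
structure PhyloTree (V : Type*) (X : Type*) extends PhyloGraph V X where
  acyclic : graph.IsAcyclic

open Classical in
/-- The map identifying a leaf of the second graph with the leaf of the first
graph carrying the same label. -/
noncomputable def mergeMap {V1 V2 X : Type*} (l1 : X → V1) (l2 : X → V2) :
    V1 ⊕ V2 → V1 ⊕ V2
  | Sum.inl v => Sum.inl v
  | Sum.inr w => if h : ∃ x, l2 x = w then Sum.inl (l1 h.choose) else Sum.inr w

lemma mergeMap_idem {V1 V2 X : Type*} (l1 : X → V1) (l2 : X → V2) (u : V1 ⊕ V2) :
    mergeMap l1 l2 (mergeMap l1 l2 u) = mergeMap l1 l2 u := by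
  classical
  cases u with
  | inl v => rfl
  | inr w =>
    by_cases h : ∃ x, l2 x = w
    · simp [mergeMap, h]
    · simp [mergeMap, h]

/-- The vertex set of the display graph: the disjoint union of the vertex sets
of the two graphs, with leaves carrying the same label identified. -/
def DisplayVertex {V1 V2 X : Type*} (l1 : X → V1) (l2 : X → V2) : Type _ :=
  {u : V1 ⊕ V2 // mergeMap l1 l2 u = u}

/-- The canonical map from `V1 ⊕ V2` to the vertex set of the display graph. -/
noncomputable def toDisplay {V1 V2 X : Type*} (l1 : X → V1) (l2 : X → V2) (u : V1 ⊕ V2) :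
    DisplayVertex l1 l2 :=
  ⟨mergeMap l1 l2 u, mergeMap_idem l1 l2 u⟩

/-- The display graph of two leaf-labelled graphs: their disjoint union with the
leaves carrying the same label identified. -/
noncomputable def displayGraph {V1 V2 X : Type*} (G1 : SimpleGraph V1) (l1 : X → V1)
    (G2 : SimpleGraph V2) (l2 : X → V2) : SimpleGraph (DisplayVertex l1 l2) :=
  SimpleGraph.fromRel (fun a b =>
    (∃ u v : V1, G1.Adj u v ∧ a = toDisplay l1 l2 (Sum.inl u) ∧ b = toDisplay l1 l2 (Sum.inl v)) ∨
    (∃ u v : V2, G2.Adj u v ∧ a = toDisplay l1 l2 (Sum.inr u) ∧ b = toDisplay l1 l2 (Sum.inr v)))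

/-- The treewidth distance between two phylogenetic trees:
`d_tw(T1,T2) = tw(D(T1,T2)) - 2`. -/
noncomputable def dtw {V1 V2 X : Type*} (T1 : PhyloTree V1 X) (T2 : PhyloTree V2 X) : ℕ :=
  treewidth (displayGraph T1.graph T1.leaf T2.graph T2.leaf) - 2

/-- Two phylogenetic trees are compatible if there is a label-preserving
isomorphism between them. -/
def Compatible {V1 V2 X : Type*} (T1 : PhyloTree V1 X) (T2 : PhyloTree V2 X) : Prop :=
  ∃ φ : T1.graph ≃g T2.graph, ∀ x : X, φ (T1.leaf x) = T2.leaf x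

/-- An unrooted binary phylogenetic tree together with a single distinguished
degree-2 internal vertex (its `hub`); all other internal vertices have
degree 3. -/
structure QTree (V : Type*) (X : Type*) where
  graph : SimpleGraph V
  finite : Finite V
  connected : graph.Connected
  acyclic : graph.IsAcyclic
  leaf : X → V
  leaf_inj : Function.Injective leaf
  leaf_deg : ∀ x : X, (graph.neighborSet (leaf x)).ncard = 1
  hub : V
  hub_not_leaf : ∀ x : X, leaf x ≠ hub
  hub_deg : (graph.neighborSet hub).ncard = 2
  internal_deg : ∀ v : V, (∀ x : X, leaf x ≠ v) → v ≠ hub → (graph.neighborSet v).ncard = 3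

/-- `T` is the quartet `ab|cd`, with the hub subdividing its middle edge:
`a, b` are attached to a common vertex, `c, d` are attached to a common vertex,
and these two vertices are the neighbours of the hub. -/
def IsQuartet {V X : Type*} (T : QTree V X) (a b c d : X) : Prop :=
  ∃ u w : V, T.graph.Adj u (T.leaf a) ∧ T.graph.Adj u (T.leaf b) ∧
    T.graph.Adj w (T.leaf c) ∧ T.graph.Adj w (T.leaf d) ∧
    T.graph.Adj T.hub u ∧ T.graph.Adj T.hub w

/-- `T'` is the doubling `(T, T)` of `T`: two copies of `T` whose hubs are
joined by an edge, subdivided by the new hub of `T'`; the taxa of the first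
(resp. second) copy are labelled by the left (resp. right) summand. -/
def IsDoubling {V V' X : Type*} (T : QTree V X) (T' : QTree V' (X ⊕ X)) : Prop :=
  ∃ φ1 φ2 : V → V',
    Function.Injective φ1 ∧ Function.Injective φ2 ∧
    (∀ v w : V, φ1 v ≠ φ2 w) ∧
    (∀ v : V, φ1 v ≠ T'.hub) ∧ (∀ v : V, φ2 v ≠ T'.hub) ∧
    (∀ w' : V', w' = T'.hub ∨ (∃ v, φ1 v = w') ∨ (∃ v, φ2 v = w')) ∧
    (∀ x : X, φ1 (T.leaf x) = T'.leaf (Sum.inl x)) ∧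
    (∀ x : X, φ2 (T.leaf x) = T'.leaf (Sum.inr x)) ∧
    (∀ u v : V, T.graph.Adj u v ↔ T'.graph.Adj (φ1 u) (φ1 v)) ∧
    (∀ u v : V, T.graph.Adj u v ↔ T'.graph.Adj (φ2 u) (φ2 v)) ∧
    (∀ u v : V, ¬ T'.graph.Adj (φ1 u) (φ2 v)) ∧
    T'.graph.Adj T'.hub (φ1 T.hub) ∧ T'.graph.Adj T'.hub (φ2 T.hub) ∧
    (∀ w' : V', T'.graph.Adj T'.hub w' → w' = φ1 T.hub ∨ w' = φ2 T.hub)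

/-- The label sets of the iterated doubling construction:
`lab 0 = Fin 4` and `lab (i+1) = lab i ⊕ lab i`. -/
def lab : ℕ → Type
  | 0 => Fin 4
  | i + 1 => lab i ⊕ lab i

/-! ### Helly property for subtrees -/

def Cvx {I : Type*} (t : SimpleGraph I) (S : Set I) : Prop :=
  ∀ x ∈ S, ∀ y ∈ S, ∃ p : t.Walk x y, ∀ z ∈ p.support, z ∈ S

lemma cvx_of_connected {I : Type*} {t : SimpleGraph I} {S : Set I}
    (h : (t.induce S).Connected) : Cvx t S := by
  intro x hx y hy
  obtain ⟨p⟩ := h.preconnected ⟨x, hx⟩ ⟨y, hy⟩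
  refine ⟨p.map (Embedding.induce S).toHom, ?_⟩
  intro z hz
  have hz' : z ∈ p.support.map (Embedding.induce S).toHom :=
    (Walk.support_map (Embedding.induce S).toHom p) ▸ hz
  obtain ⟨w, -, rfl⟩ := List.mem_map.1 hz'
  exact w.2

lemma cvx_union {I : Type*} {t : SimpleGraph I} {S S' : Set I}
    (h : Cvx t S) (h' : Cvx t S') (hne : ∃ m, m ∈ S ∧ m ∈ S') : Cvx t (S ∪ S') := by
  obtain ⟨m, hm, hm'⟩ := hne
  have key : ∀ x ∈ S ∪ S', ∃ p : t.Walk x m, ∀ z ∈ p.support, z ∈ S ∪ S' := by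
    rintro x (hx | hx)
    · obtain ⟨p, hp⟩ := h x hx m hm
      exact ⟨p, fun z hz => Or.inl (hp z hz)⟩
    · obtain ⟨p, hp⟩ := h' x hx m hm'
      exact ⟨p, fun z hz => Or.inr (hp z hz)⟩
  intro x hx y hy
  obtain ⟨p, hp⟩ := key x hx
  obtain ⟨q, hq⟩ := key y hy
  refine ⟨p.append q.reverse, fun z hz => ?_⟩
  rw [Walk.mem_support_append_iff, Walk.support_reverse, List.mem_reverse] at hz
  exact hz.elim (hp z) (hq z)

lemma acyclic_support {I : Type*} {t : SimpleGraph I} (ht : t.IsAcyclic) {x y : I}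
    (p q : t.Walk x y) :
    ∃ r : t.Walk x y, ∀ z ∈ r.support, z ∈ p.support ∧ z ∈ q.support := by
  classical
  have h : p.toPath = q.toPath := (ht.subsingleton_path _ _).elim _ _
  have h' : p.bypass = q.bypass := congrArg Subtype.val h
  refine ⟨p.bypass, fun z hz => ⟨p.support_bypass_subset_support hz, ?_⟩⟩
  rw [h'] at hz
  exact q.support_bypass_subset_support hz

lemma cvx_inter {I : Type*} {t : SimpleGraph I} (ht : t.IsAcyclic) {S S' : Set I}
    (h : Cvx t S) (h' : Cvx t S') : Cvx t (S ∩ S') := by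
  intro x hx y hy
  obtain ⟨p, hp⟩ := h x hx.1 y hy.1
  obtain ⟨q, hq⟩ := h' x hx.2 y hy.2
  obtain ⟨r, hr⟩ := acyclic_support ht p q
  exact ⟨r, fun z hz => ⟨hp z (hr z hz).1, hq z (hr z hz).2⟩⟩

lemma walk_meets {I : Type*} {t : SimpleGraph I} (ht : t.IsAcyclic) {S S' : Set I}
    (h : Cvx t S) (h' : Cvx t S') (hne : ∃ m, m ∈ S ∧ m ∈ S') {x y : I} (p : t.Walk x y) :
    x ∈ S → y ∈ S' → (∀ z ∈ p.support, z ∈ S ∨ z ∈ S') →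
    ∃ z ∈ p.support, z ∈ S ∧ z ∈ S' := by
  induction p with
  | nil => intro hx hy _; exact ⟨_, by simp, hx, hy⟩
  | @cons u v w huv p ih =>
    intro hx hy hz
    by_cases hv : v ∈ S
    · obtain ⟨z, hz, hz'⟩ := ih hv hy (fun z hz' => hz z (by simp [hz']))
      exact ⟨z, by simp [hz], hz'⟩
    · have hv' : v ∈ S' := (hz v (by simp)).resolve_left hv
      by_cases hu : u ∈ S'
      · exact ⟨u, by simp, hx, hu⟩
      · exfalso
        obtain ⟨m, hm, hm'⟩ := hne
        obtain ⟨q, hq⟩ := h u hx m hm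
        obtain ⟨q', hq'⟩ := h' m hm' v hv'
        have := isBridge_iff_forall_walk_mem_edges.1
          (isAcyclic_iff_forall_adj_isBridge.1 ht huv) (q.append q')
        rw [Walk.edges_append, List.mem_append] at this
        rcases this with h1 | h1
        · exact hv (hq _ (Walk.snd_mem_support_of_mem_edges _ h1))
        · exact hu (hq' _ (Walk.fst_mem_support_of_mem_edges _ h1))

lemma helly3 {I : Type*} {t : SimpleGraph I} (ht : t.IsAcyclic) {A B C : Set I}
    (hA : Cvx t A) (hB : Cvx t B) (hC : Cvx t C)
    (hAB : ∃ m, m ∈ A ∧ m ∈ B) (hBC : ∃ m, m ∈ B ∧ m ∈ C) (hAC : ∃ m, m ∈ A ∧ m ∈ C) :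
    ∃ m, m ∈ A ∧ m ∈ B ∧ m ∈ C := by
  obtain ⟨x, hxA, hxB⟩ := hAB
  obtain ⟨y, hyB, hyC⟩ := hBC
  obtain ⟨q, hq⟩ := cvx_union hA hC hAC x (Or.inl hxA) y (Or.inr hyC)
  obtain ⟨p, hp⟩ := hB x hxB y hyB
  obtain ⟨r, hr⟩ := acyclic_support ht p q
  obtain ⟨z, hz, hz1, hz2⟩ := walk_meets ht hA hC hAC r hxA hyC (fun z hz => hq z (hr z hz).2)
  exact ⟨z, hz1, hp z (hr z hz).1, hz2⟩

lemma helly4 {I : Type*} {t : SimpleGraph I} (ht : t.IsAcyclic) {A B C D : Set I}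
    (hA : Cvx t A) (hB : Cvx t B) (hC : Cvx t C) (hD : Cvx t D)
    (hAB : ∃ m, m ∈ A ∧ m ∈ B) (hAC : ∃ m, m ∈ A ∧ m ∈ C) (hAD : ∃ m, m ∈ A ∧ m ∈ D)
    (hBC : ∃ m, m ∈ B ∧ m ∈ C) (hBD : ∃ m, m ∈ B ∧ m ∈ D) (hCD : ∃ m, m ∈ C ∧ m ∈ D) :
    ∃ m, m ∈ A ∧ m ∈ B ∧ m ∈ C ∧ m ∈ D := by
  obtain ⟨a, h1, h2, h3⟩ := helly3 ht hA hB hD hAB hBD hAD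
  obtain ⟨b, h4, h5, h6⟩ := helly3 ht hB hC hD hBC hCD hBD
  obtain ⟨c, h7, h8, h9⟩ := helly3 ht hA hC hD hAC hCD hAD
  obtain ⟨m, hm1, hm2, hm3⟩ := helly3 ht (cvx_inter ht hA hD) (cvx_inter ht hB hD)
    (cvx_inter ht hC hD) ⟨a, ⟨h1, h3⟩, h2, h3⟩ ⟨b, ⟨h4, h6⟩, h5, h6⟩ ⟨c, ⟨h7, h9⟩, h8, h9⟩
  exact ⟨m, hm1.1, hm2.1, hm3.1, hm1.2⟩

/-! ### Lower bound -/

/-- The adjacencies of the display graph of the two quartets, on ten vertices: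
0 = h, 1 = u, 2 = w, 3 = h', 4 = u', 5 = w', 6 = a, 7 = b, 8 = c, 9 = d. -/
def edges10 : List (Fin 10 × Fin 10) :=
  [(0, 1), (0, 2), (1, 6), (1, 7), (2, 8), (2, 9), (3, 4), (3, 5), (4, 6), (4, 8), (5, 7), (5, 9)]

def HasCore {V : Type*} (G : SimpleGraph V) : Prop :=
  ∃ f : Fin 10 → V, Function.Injective f ∧ ∀ e ∈ edges10, G.Adj (f e.1) (f e.2)

lemma HasCore.map {V W : Type*} {G : SimpleGraph V} {H : SimpleGraph W} (h : HasCore G)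
    (g : V → W) (hg : Function.Injective g) (hgG : ∀ u v, G.Adj u v → H.Adj (g u) (g v)) :
    HasCore H := by
  obtain ⟨f, hf, he⟩ := h
  exact ⟨g ∘ f, hg.comp hf, fun e h => hgG _ _ (he e h)⟩

lemma HasCore.not_le_two {V : Type*} {G : SimpleGraph V} (h : HasCore G) {k : ℕ}
    (hk : HasTreeDecompWidthLE G k) : 3 ≤ k := by
  classical
  obtain ⟨f, hf, he⟩ := h
  obtain ⟨n, t, bag, ht, -, hE, hC, hcard⟩ := hk
  let S : Fin 10 → Set (Fin (n+1)) := fun j => {i | f j ∈ bag i}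
  have hS : ∀ j, Cvx t (S j) := fun j => cvx_of_connected (hC (f j))
  have hm : ∀ e ∈ edges10, ∃ m, m ∈ S e.1 ∧ m ∈ S e.2 := fun e h => hE _ _ (he e h)
  simp only [edges10, List.forall_mem_cons] at hm
  obtain ⟨⟨m01, h01, h01'⟩, ⟨m02, h02, h02'⟩, ⟨m16, h16, h16'⟩, ⟨m17, h17, h17'⟩,
    ⟨m28, h28, h28'⟩, ⟨m29, h29, h29'⟩, ⟨m34, h34, h34'⟩, ⟨m35, h35, h35'⟩, ⟨m46, h46, h46'⟩,
    ⟨m48, h48, h48'⟩, ⟨m57, h57, h57'⟩, ⟨m59, h59, h59'⟩, -⟩ := hm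
  have cA : Cvx t (((S 1 ∪ S 0) ∪ S 6) ∪ S 7) :=
    cvx_union (cvx_union (cvx_union (hS 1) (hS 0) ⟨m01, h01', h01⟩) (hS 6)
      ⟨m16, Or.inl h16, h16'⟩) (hS 7) ⟨m17, Or.inl (Or.inl h17), h17'⟩
  have cB : Cvx t ((S 4 ∪ S 3) ∪ S 8) :=
    cvx_union (cvx_union (hS 4) (hS 3) ⟨m34, h34', h34⟩) (hS 8) ⟨m48, Or.inl h48, h48'⟩
  have cC : Cvx t (S 2 ∪ S 9) := cvx_union (hS 2) (hS 9) ⟨m29, h29, h29'⟩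
  obtain ⟨m, hA, hB, hC', hD⟩ := helly4 ht.isAcyclic cA cB cC (hS 5)
    ⟨m46, Or.inl (Or.inr h46'), Or.inl (Or.inl h46)⟩
    ⟨m02, Or.inl (Or.inl (Or.inr h02)), Or.inl h02'⟩
    ⟨m57, Or.inr h57', h57⟩
    ⟨m28, Or.inr h28', Or.inl h28⟩
    ⟨m35, Or.inl (Or.inr h35), h35'⟩
    ⟨m59, Or.inr h59', h59⟩
  have hcard' := hcard m
  have main : ∀ a b c d : Fin 10, a ≠ b → a ≠ c → a ≠ d → b ≠ c → b ≠ d → c ≠ d →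
      m ∈ S a → m ∈ S b → m ∈ S c → m ∈ S d → 3 ≤ k := by
    intro a b c d ab ac ad bc bd cd ha hb hc hd
    have hsub : ({a, b, c, d} : Finset (Fin 10)).image f ⊆ bag m := by
      intro z hz
      simp only [Finset.mem_image, Finset.mem_insert, Finset.mem_singleton] at hz
      obtain ⟨j, rfl | rfl | rfl | rfl, rfl⟩ := hz <;> assumption
    have h4 := Finset.card_le_card hsub
    rw [Finset.card_image_of_injective _ hf] at h4
    have : ({a, b, c, d} : Finset (Fin 10)).card = 4 := by
      simp [Finset.card_insert_of_notMem, *]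
    omega
  rcases hA with ((hA | hA) | hA) | hA <;> rcases hB with (hB | hB) | hB <;>
    rcases hC' with hC' | hC' <;>
    exact main _ _ _ _ (by decide) (by decide) (by decide) (by decide) (by decide) (by decide)
      hA hB hC' hD

/-! ### Upper bound: gluing partial tree decompositions -/

lemma sum_walk {I J : Type*} {t : SimpleGraph I} {s : SimpleGraph J} {x y : I ⊕ J}
    (p : (t ⊕g s).Walk x y) :
    (∀ a, x = Sum.inl a → ∃ b, y = Sum.inl b ∧ ∃ q : t.Walk a b,
      ∀ e ∈ q.edges, e.map Sum.inl ∈ p.edges) ∧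
    (∀ a, x = Sum.inr a → ∃ b, y = Sum.inr b ∧ ∃ q : s.Walk a b,
      ∀ e ∈ q.edges, e.map Sum.inr ∈ p.edges) := by
  induction p with
  | nil => exact ⟨fun a h => ⟨a, h, .nil, by simp⟩, fun a h => ⟨a, h, .nil, by simp⟩⟩
  | @cons u v w huv p ih =>
    constructor
    · rintro a rfl
      rcases v with v | v
      · obtain ⟨b, hb, q, hq⟩ := ih.1 v rfl
        have hav : t.Adj a v := by simpa using huv
        refine ⟨b, hb, .cons hav q, ?_⟩
        intro e he
        rw [Walk.edges_cons, List.mem_cons] at he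
        rcases he with rfl | he
        · simp
        · simp [hq e he]
      · simp at huv
    · rintro a rfl
      rcases v with v | v
      · simp at huv
      · obtain ⟨b, hb, q, hq⟩ := ih.2 v rfl
        have hav : s.Adj a v := by simpa using huv
        refine ⟨b, hb, .cons hav q, ?_⟩
        intro e he
        rw [Walk.edges_cons, List.mem_cons] at he
        rcases he with rfl | he
        · simp
        · simp [hq e he]

lemma isAcyclic_sum {I J : Type*} {t : SimpleGraph I} {s : SimpleGraph J}
    (ht : t.IsAcyclic) (hs : s.IsAcyclic) : (t ⊕g s).IsAcyclic := by
  rw [isAcyclic_iff_forall_adj_isBridge]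
  rintro (u | u) (v | v) huv
  · rw [isBridge_iff_forall_walk_mem_edges]
    intro p
    obtain ⟨b, hb, q, hq⟩ := (sum_walk p).1 u rfl
    obtain rfl := Sum.inl_injective hb
    exact hq _ (isBridge_iff_forall_walk_mem_edges.1
      (isAcyclic_iff_forall_adj_isBridge.1 ht (by simpa using huv)) q)
  · simp at huv
  · simp at huv
  · rw [isBridge_iff_forall_walk_mem_edges]
    intro p
    obtain ⟨b, hb, q, hq⟩ := (sum_walk p).2 u rfl
    obtain rfl := Sum.inr_injective hb
    exact hq _ (isBridge_iff_forall_walk_mem_edges.1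
      (isAcyclic_iff_forall_adj_isBridge.1 hs (by simpa using huv)) q)

lemma isTree_sum_edge {I J : Type*} {t : SimpleGraph I} {s : SimpleGraph J}
    (ht : t.IsTree) (hs : s.IsTree) (i : I) (j : J) :
    ((t ⊕g s) ⊔ edge (Sum.inl i) (Sum.inr j)).IsTree :=
  ⟨ht.connected.sum_sup_edge hs.connected,
    (isAcyclic_sum ht.isAcyclic hs.isAcyclic).sup_edge_of_not_reachable
      (not_reachable_sum_inl_inr i j)⟩

lemma connected_induce_image {I J : Type*} {t : SimpleGraph I} {s : SimpleGraph J}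
    (f : I → J) (hf : ∀ x y, t.Adj x y → s.Adj (f x) (f y)) {S : Set I}
    (h : (t.induce S).Connected) : (s.induce (f '' S)).Connected := by
  refine h.map (G := t.induce S) (H := s.induce (f '' S))
    ⟨fun x => ⟨f x.1, x.1, x.2, rfl⟩, fun {x y} hxy => hf _ _ hxy⟩ ?_
  rintro ⟨_, x, hx, rfl⟩
  exact ⟨⟨x, hx⟩, rfl⟩

/-- Partial tree decompositions of width at most 3, covering exactly the vertices in `C`, at least
the pairs in `E`, with root bag `R`. -/
def PD {V : Type} (C : Set V) (E : V → V → Prop) (R : Finset V) : Prop :=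
  ∃ (I : Type) (_ : Finite I) (t : SimpleGraph I) (bag : I → Finset V) (r : I),
    t.IsTree ∧ bag r = R ∧ (∀ i, ∀ v ∈ bag i, v ∈ C) ∧ (∀ i, (bag i).card ≤ 4) ∧
    (∀ u v, E u v → ∃ i, u ∈ bag i ∧ v ∈ bag i) ∧
    (∀ v ∈ C, (t.induce {i | v ∈ bag i}).Connected)

lemma PD.single {V : Type} (R : Finset V) (h : R.card ≤ 4) :
    PD (R : Set V) (fun u v => u ∈ R ∧ v ∈ R) R := by
  refine ⟨Unit, inferInstance, ⊥, fun _ => R, (), IsTree.of_subsingleton, rfl,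
    fun _ v hv => hv, fun _ => h, fun u v h => ⟨(), h⟩, fun v hv => ?_⟩
  have : Nonempty {i : Unit | v ∈ R} := ⟨⟨(), hv⟩⟩
  exact (IsTree.of_subsingleton (G := (⊥ : SimpleGraph Unit).induce {i : Unit | v ∈ R})).connected

lemma PD.glue {V : Type} {C₁ C₂ : Set V} {E₁ E₂ : V → V → Prop} {R₁ R₂ : Finset V}
    (h₁ : PD C₁ E₁ R₁) (h₂ : PD C₂ E₂ R₂)
    (h : ∀ v, v ∈ C₁ → v ∈ C₂ → v ∈ R₁ ∧ v ∈ R₂) :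
    PD (C₁ ∪ C₂) (fun u v => E₁ u v ∨ E₂ u v) R₁ := by
  obtain ⟨I, _, t, b, r, ht, rfl, hbC, hb4, hE, hC⟩ := h₁
  obtain ⟨J, _, s, b', r', ht', rfl, hbC', hb4', hE', hC'⟩ := h₂
  refine ⟨I ⊕ J, inferInstance, (t ⊕g s) ⊔ edge (Sum.inl r) (Sum.inr r'), Sum.elim b b',
    Sum.inl r, isTree_sum_edge ht ht' r r', rfl, ?_, ?_, ?_, ?_⟩
  · rintro (i | i) v hv
    · exact Or.inl (hbC i v hv)
    · exact Or.inr (hbC' i v hv)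
  · rintro (i | i)
    · exact hb4 i
    · exact hb4' i
  · rintro u v (huv | huv)
    · obtain ⟨i, hi⟩ := hE u v huv
      exact ⟨Sum.inl i, hi⟩
    · obtain ⟨i, hi⟩ := hE' u v huv
      exact ⟨Sum.inr i, hi⟩
  · intro v hv
    have hset : {i | v ∈ Sum.elim b b' i} =
        Sum.inl '' {i | v ∈ b i} ∪ Sum.inr '' {i | v ∈ b' i} := by
      ext (i | i) <;> simp
    rw [hset]
    have c1 : v ∈ C₁ → (((t ⊕g s) ⊔ edge (Sum.inl r) (Sum.inr r')).induce
        (Sum.inl '' {i | v ∈ b i})).Connected := fun hv =>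
      connected_induce_image Sum.inl (fun x y hxy => Or.inl (by simpa using hxy)) (hC v hv)
    have c2 : v ∈ C₂ → (((t ⊕g s) ⊔ edge (Sum.inl r) (Sum.inr r')).induce
        (Sum.inr '' {i | v ∈ b' i})).Connected := fun hv =>
      connected_induce_image Sum.inr (fun x y hxy => Or.inl (by simpa using hxy)) (hC' v hv)
    by_cases h1 : v ∈ C₁
    · by_cases h2 : v ∈ C₂
      · obtain ⟨h3, h4⟩ := h v h1 h2
        exact connected_induce_union (c1 h1).preconnected (c2 h2).preconnected
          (v := Sum.inl r) (w := Sum.inr r') ⟨r, h3, rfl⟩ ⟨r', h4, rfl⟩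
          (Or.inr (by simp [edge_adj]))
      · have : {i | v ∈ b' i} = ∅ := by
          ext i; simp only [Set.mem_ofPred_eq, Set.mem_empty_iff_false, iff_false]
          exact fun hi => h2 (hbC' i v hi)
        rw [this, Set.image_empty, Set.union_empty]
        exact c1 h1
    · have : {i | v ∈ b i} = ∅ := by
        ext i; simp only [Set.mem_ofPred_eq, Set.mem_empty_iff_false, iff_false]
        exact fun hi => h1 (hbC i v hi)
      rw [this, Set.image_empty, Set.empty_union]
      exact c2 (hv.resolve_left h1)

lemma PD.map {V W : Type} {C : Set V} {E : V → V → Prop} {R : Finset V} (h : PD C E R)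
    (f : V → W) (hf : Function.Injective f) :
    PD (f '' C) (fun x y => ∃ u v, E u v ∧ f u = x ∧ f v = y) (R.map ⟨f, hf⟩) := by
  obtain ⟨I, hI, t, b, r, ht, rfl, hbC, hb4, hE, hC⟩ := h
  refine ⟨I, hI, t, fun i => (b i).map ⟨f, hf⟩, r, ht, rfl, ?_, ?_, ?_, ?_⟩
  · intro i v hv
    obtain ⟨x, hx, rfl⟩ := Finset.mem_map.1 hv
    exact ⟨x, hbC i x hx, rfl⟩
  · intro i
    rw [Finset.card_map]; exact hb4 i
  · rintro _ _ ⟨u, v, huv, rfl, rfl⟩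
    obtain ⟨i, h1, h2⟩ := hE u v huv
    exact ⟨i, Finset.mem_map.2 ⟨u, h1, rfl⟩, Finset.mem_map.2 ⟨v, h2, rfl⟩⟩
  · rintro _ ⟨v, hv, rfl⟩
    have : {i | f v ∈ (b i).map ⟨f, hf⟩} = {i | v ∈ b i} := by
      ext i; simp
    rw [this]
    exact hC v hv

lemma PD.mono {V : Type} {C C' : Set V} {E E' : V → V → Prop} {R : Finset V} (h : PD C E R)
    (hC : C = C') (hE : ∀ u v, E' u v → E u v) : PD C' E' R := by
  subst hC
  obtain ⟨I, hI, t, b, r, ht, hr, hbC, hb4, hE', hC⟩ := h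
  exact ⟨I, hI, t, b, r, ht, hr, hbC, hb4, fun u v huv => hE' u v (hE u v huv), hC⟩

lemma PD.symm {V : Type} {C : Set V} {E : V → V → Prop} {R : Finset V} (h : PD C E R) :
    PD C (fun u v => E u v ∨ E v u) R := by
  obtain ⟨I, hI, t, b, r, ht, hr, hbC, hb4, hE', hC⟩ := h
  refine ⟨I, hI, t, b, r, ht, hr, hbC, hb4, ?_, hC⟩
  rintro u v (huv | huv)
  · exact hE' u v huv
  · obtain ⟨i, h1, h2⟩ := hE' v u huv
    exact ⟨i, h2, h1⟩

lemma PD.hasTreeDecomp {V : Type} {G : SimpleGraph V} {R : Finset V}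
    (h : PD Set.univ G.Adj R) : HasTreeDecompWidthLE G 3 := by
  obtain ⟨I, hI, t, b, r, ht, hr, hbC, hb4, hE, hC⟩ := h
  obtain ⟨m, ⟨e⟩⟩ := Finite.exists_equiv_fin I
  obtain ⟨n, rfl⟩ : ∃ n, m = n + 1 := by
    refine ⟨m - 1, ?_⟩
    have := (e r).pos
    omega
  have iso : t.comap e.symm ≃g t := SimpleGraph.Iso.comap e.symm t
  refine ⟨n, t.comap e.symm, fun i => b (e.symm i), iso.isTree_iff.2 ht, ?_, ?_, ?_, ?_⟩
  · intro v
    obtain ⟨i, hi⟩ := (hC v trivial).nonempty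
    exact ⟨e i, by simpa using hi⟩
  · intro u v huv
    obtain ⟨i, hi⟩ := hE u v huv
    exact ⟨e i, by simpa using hi⟩
  · intro v
    have : {i | v ∈ b (e.symm i)} = e '' {i | v ∈ b i} := by
      ext i
      constructor
      · intro hi
        exact ⟨e.symm i, hi, by simp⟩
      · rintro ⟨j, hj, rfl⟩
        simpa using hj
    rw [this]
    exact connected_induce_image e (fun x y hxy => by simpa using hxy) (hC v trivial)
  · intro i
    exact hb4 _

/-- The decomposition of the ten-vertex core graph. -/
lemma PD_core : ∃ R : Finset (Fin 10), 0 ∈ R ∧ 3 ∈ R ∧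
    PD (V := Fin 10) Set.univ (fun u v => (u, v) ∈ edges10) R := by
  have h1 := PD.glue (PD.glue (PD.single ({0, 1, 4, 5} : Finset (Fin 10)) (by decide))
    (PD.single ({1, 6, 4} : Finset (Fin 10)) (by decide)) (by simp))
    (PD.single ({1, 7, 5} : Finset (Fin 10)) (by decide)) (by simp)
  have h2 := PD.glue (PD.glue (PD.single ({0, 2, 4, 5} : Finset (Fin 10)) (by decide))
    (PD.single ({2, 8, 4} : Finset (Fin 10)) (by decide)) (by simp))
    (PD.single ({2, 9, 5} : Finset (Fin 10)) (by decide)) (by simp)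
  have h3 := PD.glue (PD.glue (PD.single ({0, 3, 4, 5} : Finset (Fin 10)) (by decide))
    h1 (by simp)) h2 (by simp)
  refine ⟨_, by decide, by decide, h3.mono ?_ ?_⟩
  · ext x; fin_cases x <;> simp
  · decide

/-! ### Display graphs -/

lemma mergeMap_leaf {V1 V2 X : Type*} {l1 : X → V1} {l2 : X → V2} (h2 : Function.Injective l2)
    (x : X) : mergeMap l1 l2 (Sum.inr (l2 x)) = Sum.inl (l1 x) := by
  have h : ∃ y, l2 y = l2 x := ⟨x, rfl⟩
  simp only [mergeMap, h, dite_true]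
  rw [h2 h.choose_spec]

lemma mergeMap_nonleaf {V1 V2 X : Type*} {l1 : X → V1} {l2 : X → V2} {w : V2}
    (h : ∀ x, l2 x ≠ w) : mergeMap l1 l2 (Sum.inr w) = Sum.inr w := by
  have h : ¬ ∃ y, l2 y = w := fun ⟨x, hx⟩ => h x hx
  simp only [mergeMap, h, dite_false]

lemma toDisplay_leaf {V1 V2 X : Type*} {l1 : X → V1} {l2 : X → V2} (h2 : Function.Injective l2)
    (x : X) : toDisplay l1 l2 (Sum.inr (l2 x)) = toDisplay l1 l2 (Sum.inl (l1 x)) :=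
  Subtype.ext (mergeMap_leaf h2 x)

lemma toDisplay_val {V1 V2 X : Type*} {l1 : X → V1} {l2 : X → V2} (z : DisplayVertex l1 l2) :
    toDisplay l1 l2 z.1 = z := Subtype.ext z.2

lemma toDisplay_inl_inj {V1 V2 X : Type*} {l1 : X → V1} {l2 : X → V2} {u v : V1}
    (h : toDisplay l1 l2 (Sum.inl u) = toDisplay l1 l2 (Sum.inl v)) : u = v :=
  Sum.inl_injective (congrArg Subtype.val h)

lemma toDisplay_inr_inj {V1 V2 X : Type*} {l1 : X → V1} {l2 : X → V2}
    (h1 : Function.Injective l1) (h2 : Function.Injective l2) {u v : V2}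
    (h : toDisplay l1 l2 (Sum.inr u) = toDisplay l1 l2 (Sum.inr v)) : u = v := by
  have h' : mergeMap l1 l2 (Sum.inr u) = mergeMap l1 l2 (Sum.inr v) := congrArg Subtype.val h
  by_cases hu : ∃ x, l2 x = u
  · obtain ⟨x, rfl⟩ := hu
    by_cases hv : ∃ y, l2 y = v
    · obtain ⟨y, rfl⟩ := hv
      rw [mergeMap_leaf h2, mergeMap_leaf h2] at h'
      rw [h1 (Sum.inl_injective h')]
    · rw [mergeMap_leaf h2, mergeMap_nonleaf (fun x hx => hv ⟨x, hx⟩)] at h'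
      cases h'
  · rw [mergeMap_nonleaf (fun x hx => hu ⟨x, hx⟩)] at h'
    by_cases hv : ∃ y, l2 y = v
    · obtain ⟨y, rfl⟩ := hv
      rw [mergeMap_leaf h2] at h'
      cases h'
    · rw [mergeMap_nonleaf (fun x hx => hv ⟨x, hx⟩)] at h'
      exact Sum.inr_injective h'

/-- The relation generating the display graph. -/
def DRel {V1 V2 X : Type*} (G1 : SimpleGraph V1) (l1 : X → V1)
    (G2 : SimpleGraph V2) (l2 : X → V2) (a b : DisplayVertex l1 l2) : Prop :=
  (∃ u v : V1, G1.Adj u v ∧ a = toDisplay l1 l2 (Sum.inl u) ∧ b = toDisplay l1 l2 (Sum.inl v)) ∨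
  (∃ u v : V2, G2.Adj u v ∧ a = toDisplay l1 l2 (Sum.inr u) ∧ b = toDisplay l1 l2 (Sum.inr v))

lemma displayGraph_adj {V1 V2 X : Type*} (G1 : SimpleGraph V1) (l1 : X → V1)
    (G2 : SimpleGraph V2) (l2 : X → V2) (a b : DisplayVertex l1 l2) :
    (displayGraph G1 l1 G2 l2).Adj a b ↔
      a ≠ b ∧ (DRel G1 l1 G2 l2 a b ∨ DRel G1 l1 G2 l2 b a) := Iff.rfl

lemma displayGraph_adj_inl {V1 V2 X : Type*} {G1 : SimpleGraph V1} {l1 : X → V1}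
    {G2 : SimpleGraph V2} {l2 : X → V2} {u v : V1} (h : G1.Adj u v) :
    (displayGraph G1 l1 G2 l2).Adj (toDisplay l1 l2 (Sum.inl u)) (toDisplay l1 l2 (Sum.inl v)) :=
  ⟨fun he => h.ne (toDisplay_inl_inj he), Or.inl (Or.inl ⟨u, v, h, rfl, rfl⟩)⟩

lemma displayGraph_adj_inr {V1 V2 X : Type*} {G1 : SimpleGraph V1} {l1 : X → V1}
    {G2 : SimpleGraph V2} {l2 : X → V2} (h1 : Function.Injective l1) (h2 : Function.Injective l2)
    {u v : V2} (h : G2.Adj u v) :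
    (displayGraph G1 l1 G2 l2).Adj (toDisplay l1 l2 (Sum.inr u)) (toDisplay l1 l2 (Sum.inr v)) :=
  ⟨fun he => h.ne (toDisplay_inr_inj h1 h2 he), Or.inl (Or.inr ⟨u, v, h, rfl, rfl⟩)⟩

/-- The map between display graphs induced by maps between the trees. -/
noncomputable def dmap {V1 V2 X V1' V2' X' : Type*} (l1 : X → V1) (l2 : X → V2)
    (l1' : X' → V1') (l2' : X' → V2') (φ : V1 → V1') (ψ : V2 → V2') (z : DisplayVertex l1 l2) :
    DisplayVertex l1' l2' := toDisplay l1' l2' (Sum.map φ ψ z.1)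

section dmap
variable {V1 V2 X V1' V2' X' : Type*} {l1 : X → V1} {l2 : X → V2}
    {l1' : X' → V1'} {l2' : X' → V2'} {φ : V1 → V1'} {ψ : V2 → V2'} {σ : X → X'}

lemma mergeMap_map (h2 : Function.Injective l2) (h2' : Function.Injective l2')
    (hφ : ∀ x, φ (l1 x) = l1' (σ x)) (hψ : ∀ x, ψ (l2 x) = l2' (σ x))
    (hn : ∀ w x', l2' x' = ψ w → ∃ x, l2 x = w) (u : V1 ⊕ V2) :
    mergeMap l1' l2' (Sum.map φ ψ u) = Sum.map φ ψ (mergeMap l1 l2 u) := by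
  rcases u with u | w
  · rfl
  · by_cases hw : ∃ x, l2 x = w
    · obtain ⟨x, rfl⟩ := hw
      rw [mergeMap_leaf h2, Sum.map_inr, Sum.map_inl, hψ, mergeMap_leaf h2', hφ]
    · rw [mergeMap_nonleaf (fun x hx => hw ⟨x, hx⟩), Sum.map_inr,
        mergeMap_nonleaf (fun x hx => hw (hn _ _ hx))]

lemma dmap_val (h2 : Function.Injective l2) (h2' : Function.Injective l2')
    (hφ : ∀ x, φ (l1 x) = l1' (σ x)) (hψ : ∀ x, ψ (l2 x) = l2' (σ x))
    (hn : ∀ w x', l2' x' = ψ w → ∃ x, l2 x = w) (z : DisplayVertex l1 l2) :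
    (dmap l1 l2 l1' l2' φ ψ z).1 = Sum.map φ ψ z.1 := by
  change mergeMap l1' l2' (Sum.map φ ψ z.1) = _
  rw [mergeMap_map h2 h2' hφ hψ hn, z.2]

lemma dmap_toDisplay (h2 : Function.Injective l2) (h2' : Function.Injective l2')
    (hφ : ∀ x, φ (l1 x) = l1' (σ x)) (hψ : ∀ x, ψ (l2 x) = l2' (σ x))
    (hn : ∀ w x', l2' x' = ψ w → ∃ x, l2 x = w) (u : V1 ⊕ V2) :
    dmap l1 l2 l1' l2' φ ψ (toDisplay l1 l2 u) = toDisplay l1' l2' (Sum.map φ ψ u) := by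
  apply Subtype.ext
  rw [dmap_val h2 h2' hφ hψ hn]
  exact (mergeMap_map h2 h2' hφ hψ hn u).symm

lemma dmap_inj (h2 : Function.Injective l2) (h2' : Function.Injective l2')
    (hφ : ∀ x, φ (l1 x) = l1' (σ x)) (hψ : ∀ x, ψ (l2 x) = l2' (σ x))
    (hn : ∀ w x', l2' x' = ψ w → ∃ x, l2 x = w)
    (iφ : Function.Injective φ) (iψ : Function.Injective ψ) :
    Function.Injective (dmap l1 l2 l1' l2' φ ψ) := by
  intro z z' h
  have h' := congrArg Subtype.val h
  rw [dmap_val h2 h2' hφ hψ hn, dmap_val h2 h2' hφ hψ hn] at h'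
  exact Subtype.ext (iφ.sumMap iψ h')

end dmap

/-- The invariant carried along the doubling. -/
def DInv {V1 V2 X : Type} (T1 : QTree V1 X) (T2 : QTree V2 X) : Prop :=
  HasCore (displayGraph T1.graph T1.leaf T2.graph T2.leaf) ∧
  ∃ R : Finset (DisplayVertex T1.leaf T2.leaf),
    toDisplay _ _ (Sum.inl T1.hub) ∈ R ∧ toDisplay _ _ (Sum.inr T2.hub) ∈ R ∧
    PD Set.univ (DRel T1.graph T1.leaf T2.graph T2.leaf) R

lemma DInv.treewidth {V1 V2 X : Type} {T1 : QTree V1 X} {T2 : QTree V2 X} (h : DInv T1 T2) :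
    treewidth (displayGraph T1.graph T1.leaf T2.graph T2.leaf) = 3 := by
  obtain ⟨hc, R, -, -, hPD⟩ := h
  have h3 : HasTreeDecompWidthLE (displayGraph T1.graph T1.leaf T2.graph T2.leaf) 3 :=
    (hPD.symm.mono rfl (fun u v huv => ((displayGraph_adj _ _ _ _ _ _).1 huv).2)).hasTreeDecomp
  apply le_antisymm
  · exact Nat.sInf_le h3
  · exact hc.not_le_two (Nat.sInf_mem (s := {k | HasTreeDecompWidthLE _ k}) ⟨3, h3⟩)

lemma doubling_adj {V V' : Type*} {G : SimpleGraph V} {G' : SimpleGraph V'} {h : V} {h' : V'}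
    {φ1 φ2 : V → V'}
    (hcov : ∀ w' : V', w' = h' ∨ (∃ v, φ1 v = w') ∨ (∃ v, φ2 v = w'))
    (a1 : ∀ u v : V, G.Adj u v ↔ G'.Adj (φ1 u) (φ1 v))
    (a2 : ∀ u v : V, G.Adj u v ↔ G'.Adj (φ2 u) (φ2 v))
    (a12 : ∀ u v : V, ¬ G'.Adj (φ1 u) (φ2 v))
    (ah : ∀ w' : V', G'.Adj h' w' → w' = φ1 h ∨ w' = φ2 h) {u' v' : V'} (hadj : G'.Adj u' v') :
    (∃ u v, G.Adj u v ∧ u' = φ1 u ∧ v' = φ1 v) ∨ (∃ u v, G.Adj u v ∧ u' = φ2 u ∧ v' = φ2 v) ∨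
    ((u' = h' ∨ u' = φ1 h) ∧ (v' = h' ∨ v' = φ1 h)) ∨
    ((u' = h' ∨ u' = φ2 h) ∧ (v' = h' ∨ v' = φ2 h)) := by
  rcases hcov u' with rfl | ⟨u, rfl⟩ | ⟨u, rfl⟩
  · rcases ah _ hadj with rfl | rfl <;> simp
  · rcases hcov v' with rfl | ⟨v, rfl⟩ | ⟨v, rfl⟩
    · rcases ah _ hadj.symm with h | h <;> simp [h]
    · exact Or.inl ⟨u, v, (a1 _ _).2 hadj, rfl, rfl⟩
    · exact absurd hadj (a12 _ _)
  · rcases hcov v' with rfl | ⟨v, rfl⟩ | ⟨v, rfl⟩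
    · rcases ah _ hadj.symm with h | h <;> simp [h]
    · exact absurd hadj.symm (a12 _ _)
    · exact Or.inr (Or.inl ⟨u, v, (a2 _ _).2 hadj, rfl, rfl⟩)

lemma DInv.step {V1 V2 V1' V2' X : Type} {T1 : QTree V1 X} {T2 : QTree V2 X}
    {T1' : QTree V1' (X ⊕ X)} {T2' : QTree V2' (X ⊕ X)} (h : DInv T1 T2)
    (hd1 : IsDoubling T1 T1') (hd2 : IsDoubling T2 T2') : DInv T1' T2' := by
  classical
  obtain ⟨hc, R, hR1, hR2, hPD⟩ := h
  obtain ⟨φ1, φ2, iφ1, iφ2, hφ12, hφ1, hφ2, hφc, hφl1, hφl2, aφ1, aφ2, aφ12, -, -, aφh⟩ := hd1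
  obtain ⟨ψ1, ψ2, iψ1, iψ2, hψ12, hψ1, hψ2, hψc, hψl1, hψl2, aψ1, aψ2, aψ12, -, -, aψh⟩ := hd2
  have n1 : ∀ w x', T2'.leaf x' = ψ1 w → ∃ x, T2.leaf x = w := by
    rintro w (x | x) hx
    · rw [← hψl1] at hx; exact ⟨x, iψ1 hx⟩
    · rw [← hψl2] at hx; exact absurd hx.symm (hψ12 _ _)
  have n2 : ∀ w x', T2'.leaf x' = ψ2 w → ∃ x, T2.leaf x = w := by
    rintro w (x | x) hx
    · rw [← hψl1] at hx; exact absurd hx (hψ12 _ _)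
    · rw [← hψl2] at hx; exact ⟨x, iψ2 hx⟩
  set f1 := dmap T1.leaf T2.leaf T1'.leaf T2'.leaf φ1 ψ1 with hf1
  set f2 := dmap T1.leaf T2.leaf T1'.leaf T2'.leaf φ2 ψ2 with hf2
  have v1 : ∀ z, (f1 z).1 = Sum.map φ1 ψ1 z.1 :=
    dmap_val T2.leaf_inj T2'.leaf_inj hφl1 hψl1 n1
  have v2 : ∀ z, (f2 z).1 = Sum.map φ2 ψ2 z.1 :=
    dmap_val T2.leaf_inj T2'.leaf_inj hφl2 hψl2 n2
  have d1 : ∀ u, f1 (toDisplay _ _ u) = toDisplay _ _ (Sum.map φ1 ψ1 u) :=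
    dmap_toDisplay T2.leaf_inj T2'.leaf_inj hφl1 hψl1 n1
  have d2 : ∀ u, f2 (toDisplay _ _ u) = toDisplay _ _ (Sum.map φ2 ψ2 u) :=
    dmap_toDisplay T2.leaf_inj T2'.leaf_inj hφl2 hψl2 n2
  have j1 : Function.Injective f1 := dmap_inj T2.leaf_inj T2'.leaf_inj hφl1 hψl1 n1 iφ1 iψ1
  have j2 : Function.Injective f2 := dmap_inj T2.leaf_inj T2'.leaf_inj hφl2 hψl2 n2 iφ2 iψ2
  have hdisj : ∀ x y, f1 x ≠ f2 y := by
    intro x y hxy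
    have h' := congrArg Subtype.val hxy
    rw [v1, v2] at h'
    rcases hx : x.1 with a | a <;> rcases hy : y.1 with b | b <;> rw [hx, hy] at h' <;> simp at h'
    · exact hφ12 _ _ h'
    · exact hψ12 _ _ h'
  set H := toDisplay T1'.leaf T2'.leaf (Sum.inl T1'.hub) with hH
  set H' := toDisplay T1'.leaf T2'.leaf (Sum.inr T2'.hub) with hH'
  have vH : H.1 = Sum.inl T1'.hub := rfl
  have vH' : H'.1 = Sum.inr T2'.hub := mergeMap_nonleaf T2'.hub_not_leaf
  have hf1H : ∀ x, f1 x ≠ H := by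
    intro x hx
    have h' := congrArg Subtype.val hx
    rw [v1, vH] at h'
    rcases hx : x.1 with a | a <;> rw [hx] at h' <;> simp at h'
    exact hφ1 _ h'
  have hf2H : ∀ x, f2 x ≠ H := by
    intro x hx
    have h' := congrArg Subtype.val hx
    rw [v2, vH] at h'
    rcases hx : x.1 with a | a <;> rw [hx] at h' <;> simp at h'
    exact hφ2 _ h'
  have hf1H' : ∀ x, f1 x ≠ H' := by
    intro x hx
    have h' := congrArg Subtype.val hx
    rw [v1, vH'] at h'
    rcases hx : x.1 with a | a <;> rw [hx] at h' <;> simp at h'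
    exact hψ1 _ h'
  have hf2H' : ∀ x, f2 x ≠ H' := by
    intro x hx
    have h' := congrArg Subtype.val hx
    rw [v2, vH'] at h'
    rcases hx : x.1 with a | a <;> rw [hx] at h' <;> simp at h'
    exact hψ2 _ h'
  set g := toDisplay T1.leaf T2.leaf (Sum.inl T1.hub) with hg
  set g' := toDisplay T1.leaf T2.leaf (Sum.inr T2.hub) with hg'
  have r1 : ∀ u v, DRel T1.graph T1.leaf T2.graph T2.leaf u v →
      DRel T1'.graph T1'.leaf T2'.graph T2'.leaf (f1 u) (f1 v) := by
    rintro _ _ (⟨u, v, huv, rfl, rfl⟩ | ⟨u, v, huv, rfl, rfl⟩)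
    · exact Or.inl ⟨φ1 u, φ1 v, (aφ1 _ _).1 huv, d1 _, d1 _⟩
    · exact Or.inr ⟨ψ1 u, ψ1 v, (aψ1 _ _).1 huv, d1 _, d1 _⟩
  refine ⟨hc.map f1 j1 ?_, {f1 g, f1 g', H, H'}, (show H ∈ _ by simp), (show H' ∈ _ by simp), ?_⟩
  · rintro u v ⟨hne, huv⟩
    exact ⟨j1.ne hne, huv.imp (r1 _ _) (r1 _ _)⟩
  have hA := (PD.single ({f1 g, f1 g', H, H'} : Finset _) Finset.card_le_four).glue
    (hPD.map f1 j1) (by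
      rintro v hv ⟨x, -, rfl⟩
      refine ⟨hv, ?_⟩
      simp only [Finset.coe_insert, Finset.coe_singleton, Set.mem_insert_iff,
        Set.mem_singleton_iff, hf1H, hf1H', or_false, j1.eq_iff] at hv
      rcases hv with rfl | rfl
      · exact Finset.mem_map.2 ⟨_, hR1, rfl⟩
      · exact Finset.mem_map.2 ⟨_, hR2, rfl⟩)
  have hB := (PD.single ({f2 g, f2 g', H, H'} : Finset _) Finset.card_le_four).glue
    (hPD.map f2 j2) (by
      rintro v hv ⟨x, -, rfl⟩
      refine ⟨hv, ?_⟩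
      simp only [Finset.coe_insert, Finset.coe_singleton, Set.mem_insert_iff,
        Set.mem_singleton_iff, hf2H, hf2H', or_false, j2.eq_iff] at hv
      rcases hv with rfl | rfl
      · exact Finset.mem_map.2 ⟨_, hR1, rfl⟩
      · exact Finset.mem_map.2 ⟨_, hR2, rfl⟩)
  refine (hA.glue hB ?_).mono ?_ ?_
  · rintro v (hv | ⟨x, -, rfl⟩) (hv' | ⟨y, -, hy⟩)
    · exact ⟨hv, hv'⟩
    · subst hy
      simp [hf2H, hf2H', (hdisj _ _).symm] at hv
    · simp [hf1H, hf1H', hdisj] at hv'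
    · exact absurd hy.symm (hdisj _ _)
  · rw [Set.eq_univ_iff_forall]
    intro z
    rw [← toDisplay_val z]
    rcases z.1 with v' | w'
    · rcases hφc v' with rfl | ⟨v, rfl⟩ | ⟨v, rfl⟩
      · left; left; simp [← hH]
      · left; right; exact ⟨_, trivial, d1 (Sum.inl v)⟩
      · right; right; exact ⟨_, trivial, d2 (Sum.inl v)⟩
    · rcases hψc w' with rfl | ⟨v, rfl⟩ | ⟨v, rfl⟩
      · left; left; simp [← hH']
      · left; right; exact ⟨_, trivial, d1 (Sum.inr v)⟩
      · right; right; exact ⟨_, trivial, d2 (Sum.inr v)⟩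
  · have e1 : toDisplay T1'.leaf T2'.leaf (Sum.inl (φ1 T1.hub)) = f1 g := (d1 (Sum.inl T1.hub)).symm
    have e2 : toDisplay T1'.leaf T2'.leaf (Sum.inl (φ2 T1.hub)) = f2 g := (d2 (Sum.inl T1.hub)).symm
    have e3 : toDisplay T1'.leaf T2'.leaf (Sum.inr (ψ1 T2.hub)) = f1 g' := (d1 (Sum.inr T2.hub)).symm
    have e4 : toDisplay T1'.leaf T2'.leaf (Sum.inr (ψ2 T2.hub)) = f2 g' := (d2 (Sum.inr T2.hub)).symm
    rintro _ _ (⟨u', v', huv, rfl, rfl⟩ | ⟨u', v', huv, rfl, rfl⟩)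
    · rcases doubling_adj hφc aφ1 aφ2 aφ12 aφh huv with
        ⟨u, v, huv2, rfl, rfl⟩ | ⟨u, v, huv2, rfl, rfl⟩ | ⟨h1, h2⟩ | ⟨h1, h2⟩
      · left; right
        exact ⟨_, _, Or.inl ⟨u, v, huv2, rfl, rfl⟩, d1 (Sum.inl u), d1 (Sum.inl v)⟩
      · right; right
        exact ⟨_, _, Or.inl ⟨u, v, huv2, rfl, rfl⟩, d2 (Sum.inl u), d2 (Sum.inl v)⟩
      · left; left
        rcases h1 with rfl | rfl <;> rcases h2 with rfl | rfl <;> simp [e1, ← hH]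
      · right; left
        rcases h1 with rfl | rfl <;> rcases h2 with rfl | rfl <;> simp [e2, ← hH]
    · rcases doubling_adj hψc aψ1 aψ2 aψ12 aψh huv with
        ⟨u, v, huv2, rfl, rfl⟩ | ⟨u, v, huv2, rfl, rfl⟩ | ⟨h1, h2⟩ | ⟨h1, h2⟩
      · left; right
        exact ⟨_, _, Or.inr ⟨u, v, huv2, rfl, rfl⟩, d1 (Sum.inr u), d1 (Sum.inr v)⟩
      · right; right
        exact ⟨_, _, Or.inr ⟨u, v, huv2, rfl, rfl⟩, d2 (Sum.inr u), d2 (Sum.inr v)⟩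
      · left; left
        rcases h1 with rfl | rfl <;> rcases h2 with rfl | rfl <;> simp [e3, ← hH']
      · right; left
        rcases h1 with rfl | rfl <;> rcases h2 with rfl | rfl <;> simp [e4, ← hH']

/-! ### The base case -/

lemma quartet_structure {V X : Type*} (T : QTree V X) {a b c d : X}
    (hab : a ≠ b) (hac : a ≠ c) (hbc : b ≠ c) (hcd : c ≠ d)
    (h : IsQuartet T a b c d) :
    ∃ u w : V, u ≠ w ∧ u ≠ T.hub ∧ w ≠ T.hub ∧ (∀ x, T.leaf x ≠ u) ∧ (∀ x, T.leaf x ≠ w) ∧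
      T.graph.Adj T.hub u ∧ T.graph.Adj T.hub w ∧ T.graph.Adj u (T.leaf a) ∧
      T.graph.Adj u (T.leaf b) ∧ T.graph.Adj w (T.leaf c) ∧ T.graph.Adj w (T.leaf d) ∧
      (∀ v, v = T.hub ∨ v = u ∨ v = w ∨ v = T.leaf a ∨ v = T.leaf b ∨ v = T.leaf c ∨
        v = T.leaf d) ∧
      (∀ p q, T.graph.Adj p q → ∃ p' q', (p = p' ∧ q = q' ∨ p = q' ∧ q = p') ∧
        (p' = T.hub ∧ q' = u ∨ p' = T.hub ∧ q' = w ∨ p' = u ∧ q' = T.leaf a ∨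
          p' = u ∧ q' = T.leaf b ∨ p' = w ∧ q' = T.leaf c ∨ p' = w ∧ q' = T.leaf d)) := by
  classical
  obtain ⟨u, w, hua, hub, hwc, hwd, hhu, hhw⟩ := h
  have hfin : Finite V := T.finite
  have leafN : ∀ x v, T.graph.Adj v (T.leaf x) → ∀ q, T.graph.Adj (T.leaf x) q → q = v := by
    intro x v hv q hq
    obtain ⟨z, hz⟩ := Set.ncard_eq_one.1 (T.leaf_deg x)
    have h1 : v ∈ T.graph.neighborSet (T.leaf x) := hv.symm
    have h2 : q ∈ T.graph.neighborSet (T.leaf x) := hq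
    rw [hz, Set.mem_singleton_iff] at h1 h2
    rw [h1, h2]
  have nonleaf : ∀ v y z, y ≠ z → T.graph.Adj v (T.leaf y) → T.graph.Adj v (T.leaf z) →
      ∀ x, T.leaf x ≠ v := by
    rintro v y z hyz hy hz x rfl
    obtain ⟨m, hm⟩ := Set.ncard_eq_one.1 (T.leaf_deg x)
    have h1 : T.leaf y ∈ T.graph.neighborSet (T.leaf x) := hy
    have h2 : T.leaf z ∈ T.graph.neighborSet (T.leaf x) := hz
    rw [hm, Set.mem_singleton_iff] at h1 h2
    exact hyz (T.leaf_inj (h1.trans h2.symm))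
  have nbr : ∀ v y z, y ≠ z → T.graph.Adj v (T.leaf y) → T.graph.Adj v (T.leaf z) →
      T.graph.Adj T.hub v → ∀ q, T.graph.Adj v q → q = T.leaf y ∨ q = T.leaf z ∨ q = T.hub := by
    intro v y z hyz hy hz hv q hq
    have h3 := T.internal_deg v (nonleaf v y z hyz hy hz) hv.ne'
    have hsub : ({T.leaf y, T.leaf z, T.hub} : Set V) ⊆ T.graph.neighborSet v := by
      rintro x (rfl | rfl | rfl)
      · exact hy
      · exact hz
      · exact hv.symm
    have hc : ({T.leaf y, T.leaf z, T.hub} : Set V).ncard = 3 :=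
      Set.ncard_eq_three.2 ⟨_, _, _, T.leaf_inj.ne hyz, T.hub_not_leaf y, T.hub_not_leaf z, rfl⟩
    have heq := Set.eq_of_subset_of_ncard_le hsub (by rw [h3, hc]) (Set.toFinite _)
    have hq' : q ∈ T.graph.neighborSet v := hq
    rw [← heq] at hq'
    exact hq'
  have hu := nonleaf u a b hab hua hub
  have hw := nonleaf w c d hcd hwc hwd
  have Nu := nbr u a b hab hua hub hhu
  have Nw := nbr w c d hcd hwc hwd hhw
  have huw : u ≠ w := by
    rintro rfl
    rcases Nu _ hwc with h | h | h
    · exact hac (T.leaf_inj h).symm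
    · exact hbc (T.leaf_inj h).symm
    · exact T.hub_not_leaf _ h
  have Nh : ∀ q, T.graph.Adj T.hub q → q = u ∨ q = w := by
    intro q hq
    have hsub : ({u, w} : Set V) ⊆ T.graph.neighborSet T.hub := by
      rintro x (rfl | rfl)
      · exact hhu
      · exact hhw
    have heq := Set.eq_of_subset_of_ncard_le hsub (by rw [T.hub_deg, Set.ncard_pair huw])
      (Set.toFinite _)
    have hq' : q ∈ T.graph.neighborSet T.hub := hq
    rw [← heq] at hq'
    exact hq'
  have cov : ∀ v, v = T.hub ∨ v = u ∨ v = w ∨ v = T.leaf a ∨ v = T.leaf b ∨ v = T.leaf c ∨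
        v = T.leaf d := by
    have closed : ∀ x y, T.graph.Adj x y →
        x ∈ ({T.hub, u, w, T.leaf a, T.leaf b, T.leaf c, T.leaf d} : Set V) →
        y ∈ ({T.hub, u, w, T.leaf a, T.leaf b, T.leaf c, T.leaf d} : Set V) := by
      rintro x y hxy (rfl | rfl | rfl | rfl | rfl | rfl | rfl)
      · rcases Nh y hxy with rfl | rfl <;> simp
      · rcases Nu y hxy with rfl | rfl | rfl <;> simp
      · rcases Nw y hxy with rfl | rfl | rfl <;> simp
      · simp [leafN a u hua y hxy]
      · simp [leafN b u hub y hxy]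
      · simp [leafN c w hwc y hxy]
      · simp [leafN d w hwd y hxy]
    have walk : ∀ x y, T.graph.Walk x y →
        x ∈ ({T.hub, u, w, T.leaf a, T.leaf b, T.leaf c, T.leaf d} : Set V) →
        y ∈ ({T.hub, u, w, T.leaf a, T.leaf b, T.leaf c, T.leaf d} : Set V) := by
      intro x y p
      induction p with
      | nil => exact id
      | cons hxy p ih => exact fun hx => ih (closed _ _ hxy hx)
    intro v
    obtain ⟨p⟩ := T.connected.preconnected T.hub v
    exact walk _ _ p (by simp)
  refine ⟨u, w, huw, hhu.ne', hhw.ne', hu, hw, hhu, hhw, hua, hub, hwc, hwd, cov, ?_⟩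
  intro p q hpq
  rcases cov p with rfl | rfl | rfl | rfl | rfl | rfl | rfl
  · rcases Nh q hpq with rfl | rfl
    · exact ⟨_, _, Or.inl ⟨rfl, rfl⟩, by simp⟩
    · exact ⟨_, _, Or.inl ⟨rfl, rfl⟩, by simp⟩
  · rcases Nu q hpq with rfl | rfl | rfl
    · exact ⟨_, _, Or.inl ⟨rfl, rfl⟩, by simp⟩
    · exact ⟨_, _, Or.inl ⟨rfl, rfl⟩, by simp⟩
    · exact ⟨_, _, Or.inr ⟨rfl, rfl⟩, by simp⟩
  · rcases Nw q hpq with rfl | rfl | rfl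
    · exact ⟨_, _, Or.inl ⟨rfl, rfl⟩, by simp⟩
    · exact ⟨_, _, Or.inl ⟨rfl, rfl⟩, by simp⟩
    · exact ⟨_, _, Or.inr ⟨rfl, rfl⟩, by simp⟩
  · obtain rfl := leafN a u hua q hpq
    exact ⟨_, _, Or.inr ⟨rfl, rfl⟩, by simp⟩
  · obtain rfl := leafN b u hub q hpq
    exact ⟨_, _, Or.inr ⟨rfl, rfl⟩, by simp⟩
  · obtain rfl := leafN c w hwc q hpq
    exact ⟨_, _, Or.inr ⟨rfl, rfl⟩, by simp⟩
  · obtain rfl := leafN d w hwd q hpq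
    exact ⟨_, _, Or.inr ⟨rfl, rfl⟩, by simp⟩

lemma DInv.base {V1 V2 X : Type} {T1 : QTree V1 X} {T2 : QTree V2 X} {a b c d : X}
    (hab : a ≠ b) (hac : a ≠ c) (had : a ≠ d) (hbc : b ≠ c) (hbd : b ≠ d) (hcd : c ≠ d)
    (h1 : IsQuartet T1 a b c d) (h2 : IsQuartet T2 a c b d) : DInv T1 T2 := by
  obtain ⟨u, w, huw, huh, hwh, hul, hwl, A1, A2, A3, A4, A5, A6, cov1, adj1⟩ :=
    quartet_structure T1 hab hac hbc hcd h1
  obtain ⟨u', w', huw', huh', hwh', hul', hwl', B1, B2, B3, B4, B5, B6, cov2, adj2⟩ :=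
    quartet_structure T2 hac hab hbc.symm hbd h2
  have hhl := T1.hub_not_leaf
  have hhl' := T2.hub_not_leaf
  let D := toDisplay T1.leaf T2.leaf
  have leafD : ∀ x, toDisplay T1.leaf T2.leaf (Sum.inr (T2.leaf x)) = D (Sum.inl (T1.leaf x)) :=
    toDisplay_leaf T2.leaf_inj
  let f : Fin 10 → DisplayVertex T1.leaf T2.leaf :=
    ![D (Sum.inl T1.hub), D (Sum.inl u), D (Sum.inl w),
      D (Sum.inr T2.hub), D (Sum.inr u'), D (Sum.inr w'),
      D (Sum.inl (T1.leaf a)), D (Sum.inl (T1.leaf b)), D (Sum.inl (T1.leaf c)),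
      D (Sum.inl (T1.leaf d))]
  let F : Fin 10 → V1 ⊕ V2 :=
    ![Sum.inl T1.hub, Sum.inl u, Sum.inl w, Sum.inr T2.hub, Sum.inr u', Sum.inr w',
      Sum.inl (T1.leaf a), Sum.inl (T1.leaf b), Sum.inl (T1.leaf c), Sum.inl (T1.leaf d)]
  have hfF : ∀ i, (f i).1 = F i := by
    intro i
    fin_cases i
    · rfl
    · rfl
    · rfl
    · exact mergeMap_nonleaf hhl'
    · exact mergeMap_nonleaf hul'
    · exact mergeMap_nonleaf hwl'
    · rfl
    · rfl
    · rfl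
    · rfl
  have hF : Function.Injective F := by
    rw [← List.nodup_ofFn]
    simp [F, List.ofFn_succ, huw, huh, hwh, huw', huh', hwh', huh.symm, hwh.symm, huh'.symm,
      hwh'.symm, (hul _).symm, (hwl _).symm, (hhl _).symm, T1.leaf_inj.eq_iff, hab, hac, had, hbc,
      hbd, hcd]
  have hf : Function.Injective f := by
    intro i j hij
    apply hF
    rw [← hfF, ← hfF, hij]
  have ladj : ∀ {u v}, T1.graph.Adj u v →
      (displayGraph T1.graph T1.leaf T2.graph T2.leaf).Adj (D (Sum.inl u)) (D (Sum.inl v)) :=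
    fun h => displayGraph_adj_inl h
  have radj : ∀ {u v}, T2.graph.Adj u v →
      (displayGraph T1.graph T1.leaf T2.graph T2.leaf).Adj (D (Sum.inr u)) (D (Sum.inr v)) :=
    fun h => displayGraph_adj_inr T1.leaf_inj T2.leaf_inj h
  have radj' : ∀ {u x}, T2.graph.Adj u (T2.leaf x) →
      (displayGraph T1.graph T1.leaf T2.graph T2.leaf).Adj (D (Sum.inr u))
        (D (Sum.inl (T1.leaf x))) := by
    intro u x h
    rw [← leafD x]
    exact radj h
  obtain ⟨R, hR0, hR3, hPD⟩ := PD_core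
  refine ⟨⟨f, hf, ?_⟩, R.map ⟨f, hf⟩, Finset.mem_map.2 ⟨0, hR0, rfl⟩,
    Finset.mem_map.2 ⟨3, hR3, rfl⟩, (hPD.symm.map f hf).mono ?_ ?_⟩
  · simp only [edges10, List.forall_mem_cons]
    exact ⟨ladj A1, ladj A2, ladj A3, ladj A4, ladj A5, ladj A6, radj B1, radj B2, radj' B3,
      radj' B4, radj' B5, radj' B6, by simp⟩
  · rw [Set.eq_univ_iff_forall]
    intro z
    rw [← toDisplay_val z]
    rcases z.1 with v | v
    · rcases cov1 v with rfl | rfl | rfl | rfl | rfl | rfl | rfl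
      · exact ⟨0, trivial, rfl⟩
      · exact ⟨1, trivial, rfl⟩
      · exact ⟨2, trivial, rfl⟩
      · exact ⟨6, trivial, rfl⟩
      · exact ⟨7, trivial, rfl⟩
      · exact ⟨8, trivial, rfl⟩
      · exact ⟨9, trivial, rfl⟩
    · rcases cov2 v with rfl | rfl | rfl | rfl | rfl | rfl | rfl
      · exact ⟨3, trivial, rfl⟩
      · exact ⟨4, trivial, rfl⟩
      · exact ⟨5, trivial, rfl⟩
      · exact ⟨6, trivial, (leafD _).symm⟩
      · exact ⟨8, trivial, (leafD _).symm⟩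
      · exact ⟨7, trivial, (leafD _).symm⟩
      · exact ⟨9, trivial, (leafD _).symm⟩
  · have key : ∀ i j : Fin 10, (i, j) ∈ edges10 → ∀ x y p q : DisplayVertex T1.leaf T2.leaf,
        f i = p → f j = q → (x = p ∧ y = q ∨ x = q ∧ y = p) →
        ∃ u v, ((u, v) ∈ edges10 ∨ (v, u) ∈ edges10) ∧ f u = x ∧ f v = y := by
      rintro i j hij x y _ _ rfl rfl (⟨rfl, rfl⟩ | ⟨rfl, rfl⟩)
      · exact ⟨i, j, Or.inl hij, rfl, rfl⟩
      · exact ⟨j, i, Or.inr hij, rfl, rfl⟩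
    rintro _ _ (⟨p, q, hpq, rfl, rfl⟩ | ⟨p, q, hpq, rfl, rfl⟩)
    · obtain ⟨p', q', hor, hl⟩ := adj1 p q hpq
      have hor' : D (Sum.inl p) = D (Sum.inl p') ∧ D (Sum.inl q) = D (Sum.inl q') ∨
          D (Sum.inl p) = D (Sum.inl q') ∧ D (Sum.inl q) = D (Sum.inl p') := by
        rcases hor with ⟨rfl, rfl⟩ | ⟨rfl, rfl⟩ <;> simp
      rcases hl with ⟨rfl, rfl⟩ | ⟨rfl, rfl⟩ | ⟨rfl, rfl⟩ | ⟨rfl, rfl⟩ | ⟨rfl, rfl⟩ | ⟨rfl, rfl⟩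
      · exact key 0 1 (by decide) _ _ _ _ rfl rfl hor'
      · exact key 0 2 (by decide) _ _ _ _ rfl rfl hor'
      · exact key 1 6 (by decide) _ _ _ _ rfl rfl hor'
      · exact key 1 7 (by decide) _ _ _ _ rfl rfl hor'
      · exact key 2 8 (by decide) _ _ _ _ rfl rfl hor'
      · exact key 2 9 (by decide) _ _ _ _ rfl rfl hor'
    · obtain ⟨p', q', hor, hl⟩ := adj2 p q hpq
      have hor' : D (Sum.inr p) = D (Sum.inr p') ∧ D (Sum.inr q) = D (Sum.inr q') ∨
          D (Sum.inr p) = D (Sum.inr q') ∧ D (Sum.inr q) = D (Sum.inr p') := by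
        rcases hor with ⟨rfl, rfl⟩ | ⟨rfl, rfl⟩ <;> simp
      rcases hl with ⟨rfl, rfl⟩ | ⟨rfl, rfl⟩ | ⟨rfl, rfl⟩ | ⟨rfl, rfl⟩ | ⟨rfl, rfl⟩ | ⟨rfl, rfl⟩
      · exact key 3 4 (by decide) _ _ _ _ rfl rfl hor'
      · exact key 3 5 (by decide) _ _ _ _ rfl rfl hor'
      · exact key 4 6 (by decide) _ _ _ _ rfl (leafD _).symm hor'
      · exact key 4 8 (by decide) _ _ _ _ rfl (leafD _).symm hor'
      · exact key 5 7 (by decide) _ _ _ _ rfl (leafD _).symm hor'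
      · exact key 5 9 (by decide) _ _ _ _ rfl (leafD _).symm hor'

/-- In the doubled quartet construction, starting from the incompatible quartets
`T¹ = ab|cd` and `T² = ac|bd` (with subdivided middle edges) and repeatedly
doubling both trees, the display graph `Dⁱ = D(T¹ᵢ, T²ᵢ)` has treewidth 3 for
every `i`, i.e. the treewidth distance stays equal to 1. -/
theorem doubled_quartet_treewidth (V1 V2 : ℕ → Type)
    (T1 : ∀ i, QTree (V1 i) (lab i)) (T2 : ∀ i, QTree (V2 i) (lab i))
    (h1 : IsQuartet (T1 0) (0 : Fin 4) (1 : Fin 4) (2 : Fin 4) (3 : Fin 4))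
    (h2 : IsQuartet (T2 0) (0 : Fin 4) (2 : Fin 4) (1 : Fin 4) (3 : Fin 4))
    (hd1 : ∀ i, IsDoubling (T1 i) (T1 (i + 1)))
    (hd2 : ∀ i, IsDoubling (T2 i) (T2 (i + 1))) (i : ℕ) :
    treewidth (displayGraph (T1 i).graph (T1 i).leaf (T2 i).graph (T2 i).leaf) = 3 ∧
    treewidth (displayGraph (T1 i).graph (T1 i).leaf (T2 i).graph (T2 i).leaf) - 2 = 1 := by
  have hI : ∀ i, DInv (T1 i) (T2 i) := by
    intro i
    induction i with
    | zero =>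
      exact DInv.base (X := lab 0) (T1 := T1 0) (T2 := T2 0)
        (show (0 : Fin 4) ≠ 1 by decide) (show (0 : Fin 4) ≠ 2 by decide)
        (show (0 : Fin 4) ≠ 3 by decide) (show (1 : Fin 4) ≠ 2 by decide)
        (show (1 : Fin 4) ≠ 3 by decide) (show (2 : Fin 4) ≠ 3 by decide) h1 h2
    | succ i ih => exact DInv.step ih (hd1 i) (hd2 i)
  have h := (hI i).treewidth
  exact ⟨h, by rw [h]⟩
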